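/- Let f : ℝ → ℝⁿ be twice continuously differentiable. Define the energy functional E(γ) := (1/2)·∫₀¹ ‖γ'(t)‖² dt. If for every smooth h : ℝ → ℝⁿ with h(0) = 0 and h(1) = 0 the function ε ↦ E(f + ε·h) has derivative 0 at ε = 0, then f''(t) = 0 for all t ∈ [0,1]; that is, the critical points of the energy functional are the paths with vanishing acceleration (the geodesics of flat Euclidean space). -/

import Mathlib

open MeasureTheory intervalIntegral

/-- The energy functional `E(γ) = (1/2)∫₀¹ ‖γ'(t)‖² dt` of a path in `ℝⁿ`. -/
noncomputable def energyFunctional {n : ℕ} (γ : ℝ → EuclideanSpace ℝ (Fin n)) : ℝ :=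
  (1 / 2) * ∫ t in (0 : ℝ)..1, ‖deriv γ t‖ ^ 2

/-- The first variation of the energy at `f` in the direction `h` is `∫₀¹ ⟪f', h'⟫`. -/
theorem hasDerivAt_energyFunctional {n : ℕ} {f h : ℝ → EuclideanSpace ℝ (Fin n)}
    (hf : ContDiff ℝ 1 f) (hh : ContDiff ℝ 1 h) :
    HasDerivAt (fun ε : ℝ => energyFunctional (fun t => f t + ε • h t))
      (∫ t in (0 : ℝ)..1, inner ℝ (deriv f t) (deriv h t)) 0 := by
  have hf' : Continuous (deriv f) := hf.continuous_deriv le_rfl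
  have hh' : Continuous (deriv h) := hh.continuous_deriv le_rfl
  have expansion (ε : ℝ) : energyFunctional (fun t => f t + ε • h t) =
      (1 / 2) * (∫ t in (0 : ℝ)..1, ‖deriv f t‖ ^ 2) +
        ε * (∫ t in (0 : ℝ)..1, inner ℝ (deriv f t) (deriv h t)) +
        ε ^ 2 * ((1 / 2) * ∫ t in (0 : ℝ)..1, ‖deriv h t‖ ^ 2) := by
    have integrand (t : ℝ) : ‖deriv (fun t => f t + ε • h t) t‖ ^ 2 =
        ‖deriv f t‖ ^ 2 + (2 * ε) * inner ℝ (deriv f t) (deriv h t) +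
          ε ^ 2 * ‖deriv h t‖ ^ 2 := by
      have hd : HasDerivAt (fun t => f t + ε • h t) (deriv f t + ε • deriv h t) t :=
        (hf.differentiable one_ne_zero t).hasDerivAt.add
          ((hh.differentiable one_ne_zero t).hasDerivAt.const_smul ε)
      rw [hd.deriv, norm_add_sq_real, inner_smul_right, norm_smul, mul_pow, Real.norm_eq_abs,
        sq_abs]
      ring
    simp only [energyFunctional, integrand]
    rw [intervalIntegral.integral_add, intervalIntegral.integral_add,
      intervalIntegral.integral_const_mul, intervalIntegral.integral_const_mul]
    · ring
    all_goals exact Continuous.intervalIntegrable (by fun_prop) _ _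
  simp only [expansion]
  have hd := (((hasDerivAt_id (0 : ℝ)).mul_const
    (∫ t in (0 : ℝ)..1, inner ℝ (deriv f t) (deriv h t))).const_add
      ((1 / 2) * (∫ t in (0 : ℝ)..1, ‖deriv f t‖ ^ 2))).fun_add
    ((hasDerivAt_pow 2 (0 : ℝ)).mul_const ((1 / 2) * ∫ t in (0 : ℝ)..1, ‖deriv h t‖ ^ 2))
  simpa using hd

/-- **Fundamental lemma of the calculus of variations** on `[0,1]`. -/
theorem eqOn_zero_Icc_of_integral_mul_eq_zero {φ : ℝ → ℝ} (hφ : Continuous φ)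
    (h : ∀ g : ℝ → ℝ, ContDiff ℝ (⊤ : ℕ∞) g → g 0 = 0 → g 1 = 0 →
      ∫ t in (0 : ℝ)..1, g t * φ t = 0) :
    Set.EqOn φ 0 (Set.Icc 0 1) := by
  have hae : ∀ᵐ t, t ∈ Set.Ioo (0 : ℝ) 1 → φ t = 0 := by
    refine isOpen_Ioo.ae_eq_zero_of_integral_contDiff_smul_eq_zero
      (hφ.locallyIntegrable.locallyIntegrableOn _) fun g hg _ hsupp => ?_
    have hvanish (t : ℝ) (ht : t ∉ Set.Ioo (0 : ℝ) 1) : g t = 0 :=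
      image_eq_zero_of_notMem_tsupport fun hmem => ht (hsupp hmem)
    rw [← h g hg (hvanish 0 (by simp)) (hvanish 1 (by simp)),
      intervalIntegral.integral_of_le zero_le_one, integral_Ioc_eq_integral_Ioo]
    refine (setIntegral_eq_integral_of_forall_compl_eq_zero fun t ht => ?_).symm
    rw [hvanish t ht, zero_smul]
  have hIoo : Set.EqOn φ 0 (Set.Ioo 0 1) :=
    Measure.eqOn_open_of_ae_eq ((ae_restrict_iff' measurableSet_Ioo).2 hae) isOpen_Ioo
      hφ.continuousOn continuousOn_const
  rw [← closure_Ioo (zero_ne_one' ℝ)]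
  exact hIoo.closure hφ continuous_const

/-- **Geodesic equation in flat space as the Euler–Lagrange equation of the energy
functional.**  If `f` is twice continuously differentiable and for every smooth variation
`h` vanishing at the endpoints the function `ε ↦ E(f + ε·h)` has derivative `0` at
`ε = 0`, then `f'' = 0` on `[0,1]`. -/
theorem statement_2 {n : ℕ} (f : ℝ → EuclideanSpace ℝ (Fin n)) (hf : ContDiff ℝ 2 f)
    (hcrit : ∀ h : ℝ → EuclideanSpace ℝ (Fin n), ContDiff ℝ (⊤ : ℕ∞) h → h 0 = 0 → h 1 = 0 →
      HasDerivAt (fun ε : ℝ => energyFunctional (fun t => f t + ε • h t)) 0 0) :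
    ∀ t ∈ Set.Icc (0 : ℝ) 1, deriv (deriv f) t = 0 := by
  have hf' : ContDiff ℝ 1 (deriv f) := hf.deriv'
  have hf'' : Continuous (deriv (deriv f)) := hf'.continuous_deriv le_rfl
  intro t ht
  refine ext_inner_right ℝ fun v => ?_
  rw [inner_zero_left]
  refine eqOn_zero_Icc_of_integral_mul_eq_zero (φ := fun s => inner ℝ (deriv (deriv f) s) v)
    (by fun_prop) (fun g hg hg0 hg1 => ?_) ht
  have hg_one : ContDiff ℝ 1 g := hg.of_le (by exact_mod_cast le_top)
  have hg' : Continuous (deriv g) := hg_one.continuous_deriv le_rfl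
  have hderiv (s : ℝ) : deriv (fun s => g s • v) s = deriv g s • v :=
    ((hg_one.differentiable one_ne_zero s).hasDerivAt.smul_const v).deriv
  have hvar : ∫ s in (0 : ℝ)..1, inner ℝ (deriv f s) v * deriv g s = 0 := by
    have := (hasDerivAt_energyFunctional (h := fun s => g s • v) (hf.of_le one_le_two)
      (hg_one.smul contDiff_const)).unique
        (hcrit (fun s => g s • v) (hg.smul contDiff_const) (by simp [hg0]) (by simp [hg1]))
    simpa only [hderiv, inner_smul_right, mul_comm] using this
  have hparts := integral_mul_deriv_eq_deriv_mul (a := 0) (b := 1)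
    (u := fun s => inner ℝ (deriv f s) v) (u' := fun s => inner ℝ (deriv (deriv f) s) v)
    (v := g) (v' := deriv g)
    (fun s _ => by
      simpa using (hf'.differentiable one_ne_zero s).hasDerivAt.inner ℝ (hasDerivAt_const s v))
    (fun s _ => (hg_one.differentiable one_ne_zero s).hasDerivAt)
    (Continuous.intervalIntegrable (by fun_prop) _ _) (hg'.intervalIntegrable _ _)
  rw [hvar, hg0, hg1] at hparts
  simp only [mul_comm (g _)]
  linarith
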